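/- For the cycle graph C_n, the generating function Σ_{k≥0} #|kq| z^k equals (1/n) Σ_{d | n} φ(d)/(1 − z^d)^{n/d}, where φ is Euler's totient function. -/

import Mathlib

open PowerSeries

/-- The Laplacian matrix of the cycle graph `C_n` (vertices `ZMod n`). -/
def cycLap (n : ℕ) : Matrix (ZMod n) (ZMod n) ℤ :=
  Matrix.of fun i j =>
    (if i = j then 2 else 0) - (if j = i + 1 then 1 else 0) - (if j = i - 1 then 1 else 0)

theorem cyc_mulVec (n : ℕ) [NeZero n] (f : ZMod n → ℤ) (i : ZMod n) :
    (cycLap n).mulVec f i = 2 * f i - f (i + 1) - f (i - 1) := by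
  simp [cycLap, Matrix.mulVec, dotProduct, sub_mul, Finset.sum_sub_distrib]

theorem cyc_sum_range {M : Type*} [AddCommMonoid M] (n : ℕ) [NeZero n] (A : ZMod n → M) :
    ∑ j ∈ Finset.range n, A (j : ZMod n) = ∑ i, A i := by
  refine Finset.sum_bij' (fun j _ => (j : ZMod n)) (fun i _ => i.val) ?_ ?_ ?_ ?_ ?_
  · simp
  · intro i _; simpa using ZMod.val_lt i
  · intro j hj
    exact ZMod.val_cast_of_lt (Finset.mem_range.mp hj)
  · simp
  · simp

theorem cyc_prod_range {M : Type*} [CommMonoid M] (n : ℕ) [NeZero n] (A : ZMod n → M) :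
    ∏ j ∈ Finset.range n, A (j : ZMod n) = ∏ i, A i := 
  cyc_sum_range (M := Additive M) n A

theorem cyc_antideriv (n : ℕ) [NeZero n] (A : ZMod n → ℤ) (hA : ∑ i, A i = 0) :
    ∃ g : ZMod n → ℤ, ∀ i, g (i + 1) - g i = A i := by
  set G : ℕ → ℤ := fun m => ∑ j ∈ Finset.range m, A (j : ZMod n) with hG
  have hper : Function.Periodic G n := by
    intro m
    simp only [hG]
    rw [add_comm, Finset.sum_range_add, cyc_sum_range, hA]
    simp
  refine ⟨fun i => G i.val, fun i => ?_⟩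
  have h1 : G (i + 1).val = G (i.val + 1) := by
    rw [ZMod.val_add, ZMod.val_one_eq_one_mod, Nat.add_mod_mod, hper.map_mod_nat]
  show G (i + 1).val - G i.val = A i
  rw [h1]
  simp [hG, Finset.sum_range_succ]

theorem cyc_shift {M : Type*} [AddCommMonoid M] (n : ℕ) [NeZero n] (A : ZMod n → M) (c : ZMod n) :
    ∑ i, A (i + c) = ∑ i, A i :=
  Equiv.sum_comp (Equiv.addRight c) A

theorem cyc_image (n : ℕ) [NeZero n] (D : ZMod n → ℤ) :
    (∃ f : ZMod n → ℤ, D = (cycLap n).mulVec f) ↔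
      (∑ i, D i = 0 ∧ ∑ i, (D i : ZMod n) * i = 0) := by
  constructor
  · rintro ⟨f, rfl⟩
    simp only [cyc_mulVec]
    constructor
    · have h1 := cyc_shift n f 1
      have h2 := cyc_shift n f (-1)
      simp only [← sub_eq_add_neg] at h2
      rw [Finset.sum_sub_distrib, Finset.sum_sub_distrib, h1, h2, ← Finset.mul_sum]
      ring
    · have h1 := cyc_shift n (fun i => (f i : ZMod n) * (i - 1)) 1
      have h2 := cyc_shift n (fun i => (f i : ZMod n) * (i + 1)) (-1)
      simp only [← sub_eq_add_neg] at h2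
      simp only [add_sub_cancel_right, sub_add_cancel] at h1 h2
      push_cast
      simp only [sub_mul, Finset.sum_sub_distrib]
      rw [h1, h2, ← Finset.sum_sub_distrib, ← Finset.sum_sub_distrib]
      apply Finset.sum_eq_zero
      intro i _
      ring
  · rintro ⟨h0, h1⟩
    obtain ⟨g, hg⟩ := cyc_antideriv n D h0
    -- D i = g (i+1) - g i
    have hdvd : (n : ℤ) ∣ ∑ i, g i := by
      rw [← ZMod.intCast_zmod_eq_zero_iff_dvd] 
      have h2 := cyc_shift n (fun i => (g i : ZMod n) * (i - 1)) 1
      simp only [add_sub_cancel_right] at h2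
      simp only [← hg] at h1
      push_cast at h1 ⊢
      simp only [sub_mul, Finset.sum_sub_distrib] at h1
      rw [h2, ← Finset.sum_sub_distrib] at h1
      rw [← neg_eq_zero, ← Finset.sum_neg_distrib, ← h1]
      apply Finset.sum_congr rfl
      intro i _
      ring
    obtain ⟨c, hc⟩ := hdvd
    obtain ⟨f, hf⟩ := cyc_antideriv n (fun i => c - g i) (by
      simp [Finset.sum_sub_distrib, hc])
    refine ⟨fun i => f (i + 1), ?_⟩
    funext i
    rw [cyc_mulVec, sub_add_cancel]
    have e1 := hf i
    have e2 := hf (i + 1)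
    have e3 := hg i
    linarith

theorem geo_mul (w : ℂ) : (PowerSeries.mk fun m => w ^ m) * (1 - C w * X) = 1 := by
  ext m
  rw [mul_sub, mul_one, ← mul_assoc, map_sub, coeff_mk, coeff_one]
  cases m with
  | zero => simp
  | succ m => simp [coeff_succ_mul_X, mul_comm (PowerSeries.mk _) (C w), pow_succ']

theorem prod_primitive (d : ℕ) (hd : 0 < d) (w : ℂ) (hw : IsPrimitiveRoot w d) :
    ∏ j ∈ Finset.range d, (1 - C (w ^ j) * X : PowerSeries ℂ) = 1 - X ^ d := by
  classical
  have hw' : IsPrimitiveRoot (C w : PowerSeries ℂ) d := hw.map_of_injective C_injective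
  have h := hw'.pow_sub_pow_eq_prod_sub_mul 1 (X : PowerSeries ℂ) hd
  rw [one_pow] at h
  rw [h]
  have himg : Polynomial.nthRootsFinset d (1 : PowerSeries ℂ)
      = (Finset.range d).image (fun j => (C w : PowerSeries ℂ) ^ j) := by
    symm
    apply Finset.eq_of_subset_of_card_le
    · intro x hx
      obtain ⟨j, -, rfl⟩ := Finset.mem_image.mp hx
      rw [Polynomial.mem_nthRootsFinset hd, ← pow_mul, mul_comm, pow_mul, hw'.pow_eq_one, one_pow]
    · rw [hw'.card_nthRootsFinset, Finset.card_image_of_injOn hw'.injOn_pow, Finset.card_range]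
  rw [himg, Finset.prod_image hw'.injOn_pow]
  simp

theorem prod_char (n : ℕ) [NeZero n] (a : ZMod n) :
    ∏ v : ZMod n, (1 - C (ZMod.stdAddChar (v * a)) * X : PowerSeries ℂ)
      = (1 - X ^ (addOrderOf a)) ^ (n / addOrderOf a) := by
  have hd : 0 < addOrderOf a := addOrderOf_pos a
  have hdvd : addOrderOf a ∣ n := by
    simpa using addOrderOf_dvd_card (x := a)
  have hw : IsPrimitiveRoot (ZMod.stdAddChar a : ℂ) (addOrderOf a) := by
    have h := IsPrimitiveRoot.orderOf (ZMod.stdAddChar a : ℂ)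
    have h2 : orderOf (ZMod.stdAddChar a : ℂ) = addOrderOf a := by
      have := orderOf_injective (ZMod.stdAddChar (N := n)).toMonoidHom
        ZMod.injective_stdAddChar (Multiplicative.ofAdd a)
      rwa [orderOf_ofAdd_eq_addOrderOf] at this
    rwa [h2] at h
  set d := addOrderOf a
  set w : ℂ := ZMod.stdAddChar a with hwdef
  obtain ⟨m, hm⟩ := hdvd
  have hnd : n / d = m := by rw [hm]; exact Nat.mul_div_cancel_left m hd
  rw [hnd, ← cyc_prod_range]
  have h1 : ∀ j : ℕ, (ZMod.stdAddChar ((j : ZMod n) * a) : ℂ) = w ^ j := by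
    intro j
    rw [← nsmul_eq_mul, AddChar.map_nsmul_eq_pow]
  simp only [h1]
  have h2 : ∀ m : ℕ, ∏ j ∈ Finset.range (d * m), (1 - C (w ^ j) * X : PowerSeries ℂ)
      = (1 - X ^ d) ^ m := by
    intro m
    induction m with
    | zero => simp
    | succ m ih =>
      rw [Nat.mul_succ, Finset.prod_range_add, ih, pow_succ]
      congr 1
      rw [← prod_primitive d hd w hw]
      apply Finset.prod_congr rfl
      intro j _
      rw [pow_add, pow_mul, hw.pow_eq_one, one_pow, one_mul]
  rw [← h2 m, ← hm]

theorem card_eq (n : ℕ) [NeZero n] (k : ℕ) :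
    Nat.card {E : ZMod n → ℤ // (∀ v, 0 ≤ E v) ∧
          ∃ f : ZMod n → ℤ, E - Pi.single 0 (k : ℤ) = (cycLap n).mulVec f}
    = ((Finset.finsuppAntidiag (Finset.univ : Finset (ZMod n)) k).filter
        (fun l => ∑ v, (l v : ZMod n) * v = 0)).card := by
  classical
  have key : ∀ l : ZMod n → ℕ,
      (∃ f : ZMod n → ℤ, (fun v => (l v : ℤ)) - Pi.single 0 (k : ℤ) = (cycLap n).mulVec f) ↔
        (∑ v, l v = k ∧ ∑ v, (l v : ZMod n) * v = 0) := by
    intro l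
    rw [cyc_image]
    apply and_congr
    · simp only [Pi.sub_apply, Finset.sum_sub_distrib, Finset.sum_pi_single', Finset.mem_univ,
        if_true]
      rw [sub_eq_zero]
      exact_mod_cast Iff.rfl
    · have : ∀ i : ZMod n, (((Pi.single 0 (k : ℤ) : ZMod n → ℤ) i : ℤ) : ZMod n) * i = 0 := by
        intro i
        by_cases hi : i = 0
        · simp [hi]
        · simp [Pi.single_eq_of_ne hi]
      simp [Pi.sub_apply, sub_mul, this]
  rw [← Fintype.card_coe, ← Nat.card_eq_fintype_card]
  symm
  refine Nat.card_eq_of_bijective (fun l => ⟨fun v => ((l.1 v : ℕ) : ℤ), fun v => by positivity, ?_⟩)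
    ⟨?_, ?_⟩
  · have h := l.2
    rw [Finset.mem_filter, Finset.mem_finsuppAntidiag] at h
    exact (key _).2 ⟨h.1.1, h.2⟩
  · intro l l' h
    apply Subtype.ext
    ext v
    have : ((l.1 v : ℕ) : ℤ) = ((l'.1 v : ℕ) : ℤ) := congrFun (congrArg Subtype.val h) v
    exact_mod_cast this
  · rintro ⟨E, hE0, hE⟩
    have hE' : (fun v => (((E v).toNat : ℕ) : ℤ)) = E := by
      funext v
      exact Int.toNat_of_nonneg (hE0 v)
    rw [← hE', key] at hE
    refine ⟨⟨Finsupp.equivFunOnFinite.symm (fun v => (E v).toNat), ?_⟩, ?_⟩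
    · rw [Finset.mem_filter, Finset.mem_finsuppAntidiag]
      exact ⟨⟨hE.1, Finset.subset_univ _⟩, hE.2⟩
    · exact Subtype.ext hE'

theorem gf_complex (n : ℕ) [NeZero n] (k : ℕ) :
    (n : ℂ) * (((Finset.finsuppAntidiag (Finset.univ : Finset (ZMod n)) k).filter
        (fun l => ∑ v, (l v : ZMod n) * v = 0)).card : ℂ)
    = coeff k (∑ d ∈ n.divisors, (d.totient : ℂ) •
            (((1 - (PowerSeries.X : PowerSeries ℂ) ^ d) ^ (n / d))⁻¹)) := by
  classical
  have h1 : ∀ a : ZMod n, ((1 - (X : PowerSeries ℂ) ^ (addOrderOf a)) ^ (n / addOrderOf a))⁻¹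
      = ∏ v : ZMod n, PowerSeries.mk fun m => (ZMod.stdAddChar (v * a) : ℂ) ^ m := by
    intro a
    rw [← prod_char]
    symm
    rw [PowerSeries.eq_inv_iff_mul_eq_one, ← Finset.prod_mul_distrib]
    · exact Finset.prod_eq_one fun v _ => geo_mul _
    · simp [map_prod]
  have h2 : ∑ d ∈ n.divisors, (d.totient : ℂ) •
            (((1 - (PowerSeries.X : PowerSeries ℂ) ^ d) ^ (n / d))⁻¹)
      = ∑ a : ZMod n, ((1 - (X : PowerSeries ℂ) ^ (addOrderOf a)) ^ (n / addOrderOf a))⁻¹ := by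
    rw [← Finset.sum_fiberwise_of_maps_to (s := Finset.univ) (t := n.divisors)
      (g := fun a : ZMod n => addOrderOf a)]
    · apply Finset.sum_congr rfl
      intro d hd
      have hc := IsAddCyclic.card_addOrderOf_eq_totient (α := ZMod n) (d := d)
        (by rw [ZMod.card]; exact Nat.dvd_of_mem_divisors hd)
      rw [Finset.sum_congr rfl (g := fun _ => ((1 - (X : PowerSeries ℂ) ^ d) ^ (n / d))⁻¹),
        Finset.sum_const, hc, Nat.cast_smul_eq_nsmul]
      intro a ha
      rw [(Finset.mem_filter.mp ha).2]
    · intro a _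
      rw [Nat.mem_divisors]
      exact ⟨by simpa using addOrderOf_dvd_card (x := a), NeZero.ne n⟩
  rw [h2, map_sum]
  simp only [h1, coeff_prod, coeff_mk]
  rw [Finset.sum_comm, Finset.card_filter, Nat.cast_sum, Finset.mul_sum]
  apply Finset.sum_congr rfl
  intro l _
  have h3 : ∀ a : ZMod n, ∏ v : ZMod n, (ZMod.stdAddChar (v * a) : ℂ) ^ (l v)
      = ZMod.stdAddChar (a * (∑ v, (l v : ZMod n) * v)) := by
    intro a
    have hsum : ∀ g : ZMod n → ZMod n,
        (ZMod.stdAddChar (∑ v, g v) : ℂ) = ∏ v, ZMod.stdAddChar (g v) := fun g =>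
      map_prod (ZMod.stdAddChar (N := n)).toMonoidHom (fun v => Multiplicative.ofAdd (g v))
        Finset.univ
    rw [Finset.mul_sum, hsum]
    apply Finset.prod_congr rfl
    intro v _
    rw [← AddChar.map_nsmul_eq_pow, nsmul_eq_mul]
    congr 1
    ring
  simp only [h3]
  rw [AddChar.sum_mulShift _ (ZMod.isPrimitive_stdAddChar n)]
  simp

/-- For the cycle graph `C_n` (with `q = 0`),
`∑_{k≥0} #|kq| z^k = (1/n) ∑_{d ∣ n} φ(d)/(1-z^d)^{n/d}`. -/
theorem stmt15 (n : ℕ) [NeZero n] (hn : 1 ≤ n) :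
    (PowerSeries.mk fun k =>
        (Nat.card {E : ZMod n → ℤ // (∀ v, 0 ≤ E v) ∧
          ∃ f : ZMod n → ℤ, E - Pi.single 0 (k : ℤ) = (cycLap n).mulVec f} : ℚ))
      = (n : ℚ)⁻¹ •
          ∑ d ∈ n.divisors, (d.totient : ℚ) •
            (((1 - (PowerSeries.X : PowerSeries ℚ) ^ d) ^ (n / d))⁻¹) := by
  ext k
  rw [coeff_mk, card_eq]
  have hmap : PowerSeries.map (algebraMap ℚ ℂ) (∑ d ∈ n.divisors, (d.totient : ℚ) •
            (((1 - (PowerSeries.X : PowerSeries ℚ) ^ d) ^ (n / d))⁻¹))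
      = ∑ d ∈ n.divisors, (d.totient : ℂ) •
            (((1 - (PowerSeries.X : PowerSeries ℂ) ^ d) ^ (n / d))⁻¹) := by
    rw [map_sum]
    apply Finset.sum_congr rfl
    intro d hd
    have hd0 : d ≠ 0 := (Nat.pos_of_mem_divisors hd).ne'
    rw [Nat.cast_smul_eq_nsmul, Nat.cast_smul_eq_nsmul, map_nsmul]
    congr 1
    rw [PowerSeries.eq_inv_iff_mul_eq_one (by simp [hd0])]
    have : (1 - (X : PowerSeries ℂ) ^ d) ^ (n / d)
      = PowerSeries.map (algebraMap ℚ ℂ) ((1 - X ^ d) ^ (n / d)) := by simp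
    rw [this, ← map_mul, PowerSeries.inv_mul_cancel _ (by simp [hd0]), map_one]
  have h := gf_complex n k
  rw [← hmap, coeff_map] at h
  have hn0 : (n : ℚ) ≠ 0 := by exact_mod_cast (NeZero.ne n)
  rw [map_smul, smul_eq_mul, eq_inv_mul_iff_mul_eq₀ hn0]
  apply (algebraMap ℚ ℂ).injective
  rw [← h]
  simp
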